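/- arXiv:1503.04753 — 2 statements merged into one kernel-verified Lean document; each statement's English description precedes it below -/
import Mathlib

section
/- Let G = (V,E,c) be a feasible precedence graph and R ⊆ E. Then R is an index set of redundant relations (i.e., the inequality systems for (V,E,c) and (V, E∖R, c restricted to E∖R) have the same solution set) if and only if R is a redundant edge set of G, meaning that for every edge (u,v) ∈ R there exists a path from u to v in the subgraph (V, E∖R, c) of weight at most c_{uv}. -/
/-- `l` is a walk in edge set `E`: a nonempty list of vertices with consecutive edges. -/
def IsWalk {V : Type*} (E : Set (V × V)) (l : List V) : Prop :=
  l ≠ [] ∧ l.Chain' (fun a b => (a, b) ∈ E)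

/-- The weight of a walk: sum of edge weights along consecutive pairs (with multiplicity). -/
def walkWeight {V : Type*} (c : V → V → ℝ) (l : List V) : ℝ :=
  ((l.zip l.tail).map fun p => c p.1 p.2).sum

/-- `l` is a walk from `u` to `v`. -/
def IsWalkFrom {V : Type*} (E : Set (V × V)) (u v : V) (l : List V) : Prop :=
  IsWalk E l ∧ l.head? = some u ∧ l.getLast? = some v

/-- A closed walk: a walk with at least one edge whose first and last vertices agree. -/
def IsClosedWalk {V : Type*} (E : Set (V × V)) (l : List V) : Prop :=
  IsWalk E l ∧ 2 ≤ l.length ∧ l.head? = l.getLast?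

/-- A simple path from `u` to `v`: a walk with all traversed vertices distinct. -/
def IsPathFrom {V : Type*} (E : Set (V × V)) (u v : V) (l : List V) : Prop :=
  IsWalkFrom E u v l ∧ l.Nodup

/-- A cycle: a closed walk all of whose vertices other than the repeated endpoint are distinct. -/
def IsCycle {V : Type*} (E : Set (V × V)) (l : List V) : Prop :=
  IsClosedWalk E l ∧ l.tail.Nodup

/-- `x` satisfies the precedence relation system of `(V, E, c)`. -/
def Satisfies {V : Type*} (E : Set (V × V)) (c : V → V → ℝ) (x : V → ℝ) : Prop :=
  ∀ e ∈ E, x e.1 - x e.2 ≤ c e.1 e.2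

/-- `R` is a redundant edge set of `(V, E, c)`: every edge of `R` has a replacement path
in the reduced graph of no greater weight. -/
def IsRedundantEdgeSet {V : Type*} (E : Set (V × V)) (c : V → V → ℝ)
    (R : Set (V × V)) : Prop :=
  R ⊆ E ∧ ∀ e ∈ R, ∃ l, IsPathFrom (E \ R) e.1 e.2 l ∧ walkWeight c l ≤ c e.1 e.2

/-- `w` is the minimum weight of a walk from `i` to `j` in `(V, E, c)` (attained). -/
def IsMinWalkWeight {V : Type*} (E : Set (V × V)) (c : V → V → ℝ) (i j : V) (w : ℝ) : Prop :=
  (∃ l, IsWalkFrom E i j l ∧ walkWeight c l = w) ∧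
  ∀ l, IsWalkFrom E i j l → w ≤ walkWeight c l

/-- The relation `∼`: `i ∼ j` iff `i = j` or some zero-weight closed walk traverses both. -/
def Sim {V : Type*} (E : Set (V × V)) (c : V → V → ℝ) (i j : V) : Prop :=
  i = j ∨ ∃ l, IsClosedWalk E l ∧ walkWeight c l = 0 ∧ i ∈ l ∧ j ∈ l

theorem ww_cons {V : Type*} (c : V → V → ℝ) (a b : V) (t : List V) :
    walkWeight c (a :: b :: t) = c a b + walkWeight c (b :: t) := by
  simp [walkWeight]

theorem tele {V : Type*} (F : Set (V × V)) (c : V → V → ℝ) (x : V → ℝ)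
    (hx : Satisfies F c x) (v : V) (t : List V) : ∀ a, IsWalkFrom F a v (a :: t) →
    x a - x v ≤ walkWeight c (a :: t) := by
  induction t with
  | nil =>
    intro a h
    have : a = v := by simpa using h.2.2
    subst this
    simp [walkWeight]
  | cons b t ih =>
    intro a h
    obtain ⟨⟨_, h2⟩, _, h4⟩ := h
    have h5 := List.isChain_cons_cons.1 h2
    rw [ww_cons]
    have := ih b ⟨⟨by simp, h5.2⟩, by simp, by simpa using h4⟩
    have := hx (a, b) h5.1
    simp only at this
    linarith

theorem suffix_path {V : Type*} (F : Set (V × V)) (c : V → V → ℝ) (x : V → ℝ)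
    (hx : Satisfies F c x) (v i : V) (t : List V) : ∀ a, IsPathFrom F a v (a :: t) →
    i ∈ a :: t → ∃ m, IsPathFrom F i v m ∧ x a - x i + walkWeight c m ≤ walkWeight c (a :: t) := by
  induction t with
  | nil =>
    intro a h hi
    have : i = a := by simpa using hi
    subst this
    exact ⟨_, h, by simp⟩
  | cons b t ih =>
    intro a h hi
    by_cases hia : i = a
    · subst hia
      exact ⟨_, h, by simp⟩
    obtain ⟨⟨⟨_, h2⟩, _, h4⟩, hn⟩ := h
    have h5 := List.isChain_cons_cons.1 h2
    rw [ww_cons]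
    obtain ⟨m, hm, hw⟩ := ih b ⟨⟨⟨by simp, h5.2⟩, by simp, by simpa using h4⟩, (List.nodup_cons.1 hn).2⟩
      (List.mem_of_ne_of_mem hia hi)
    have := hx (a, b) h5.1
    simp only at this
    exact ⟨m, hm, by linarith⟩

theorem extend_path {V : Type*} (F : Set (V × V)) (c : V → V → ℝ) (x : V → ℝ)
    (hx : Satisfies F c x) (v i j : V) (hij : (i, j) ∈ F) (l : List V) (hl : IsPathFrom F j v l) :
    ∃ m, IsPathFrom F i v m ∧ walkWeight c m ≤ c i j + walkWeight c l := by
  obtain ⟨t, rfl⟩ : ∃ t, l = j :: t := by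
    cases l with
    | nil => exact absurd rfl hl.1.1.1
    | cons a t =>
      have : a = j := by simpa using hl.1.2.1
      exact ⟨t, by rw [this]⟩
  by_cases hi : i ∈ j :: t
  · obtain ⟨m, hm, hw⟩ := suffix_path F c x hx v i t j hl hi
    have := hx (i, j) hij
    simp only at this
    exact ⟨m, hm, by linarith⟩
  · obtain ⟨⟨⟨_, h2⟩, _, h4⟩, hn⟩ := hl
    exact ⟨i :: j :: t, ⟨⟨⟨by simp, List.isChain_cons_cons.2 ⟨hij, h2⟩⟩, by simp, by simpa using h4⟩,
      List.nodup_cons.2 ⟨hi, hn⟩⟩, (ww_cons c i j t).le⟩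

theorem stmt4 {V : Type*} [Fintype V] (E : Set (V × V)) (c : V → V → ℝ)
    (hfeas : ∃ x : V → ℝ, Satisfies E c x)
    (hloop : ∀ i : V, (i, i) ∉ E)
    (R : Set (V × V)) (hR : R ⊆ E) :
    (∀ x : V → ℝ, Satisfies E c x ↔ Satisfies (E \ R) c x) ↔
      IsRedundantEdgeSet E c R := by
  classical
  constructor
  · intro h
    refine ⟨hR, ?_⟩
    rintro ⟨u, v⟩ he
    obtain ⟨x, hxE⟩ := hfeas
    have hx := (h x).1 hxE
    set F := E \ R with hF
    have hfin : {l : List V | l.Nodup}.Finite :=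
      Set.finite_coe_iff.1 (inferInstanceAs (Finite {l : List V // l.Nodup}))
    let M : ℝ := c u v - x u + 1
    let A : V → Set ℝ := fun i =>
      insert (M + x i) (Set.image (walkWeight c) {l | IsPathFrom F i v l})
    have hA : ∀ i, ∃ w ∈ A i, ∀ z ∈ A i, w ≤ z := by
      intro i
      have hf : (A i).Finite := ((hfin.subset (fun l hl => hl.2)).image _).insert _
      exact Set.exists_min_image (A i) id hf ⟨_, Set.mem_insert _ _⟩
    choose y hy hmin using hA
    have hyF : Satisfies F c y := by
      rintro ⟨i, j⟩ hij
      simp only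
      rcases hy j with hj | ⟨l, hl, hj⟩
      · have h1 := hmin i _ (Set.mem_insert _ _)
        have h2 := hx (i, j) hij
        simp only at h2
        linarith
      · obtain ⟨m, hm, hw⟩ := extend_path F c x hx v i j hij l hl
        have h1 := hmin i _ (Set.mem_insert_of_mem _ ⟨m, hm, rfl⟩)
        linarith
    have hyE := (h y).2 hyF (u, v) (hR he)
    have hv : y v ≤ 0 := by
      refine hmin v 0 (Set.mem_insert_of_mem _ ⟨[v], ⟨⟨⟨by simp, List.isChain_singleton _⟩, by simp, by simp⟩, by simp⟩, ?_⟩)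
      simp [walkWeight]
    simp only at hyE ⊢
    rcases hy u with hu | ⟨l, hl, hu⟩
    · simp only [M] at hu
      linarith
    · exact ⟨l, hl, by linarith⟩
  · rintro ⟨_, h⟩ x
    refine ⟨fun hx e he => hx e he.1, fun hx e he => ?_⟩
    by_cases heR : e ∈ R
    · obtain ⟨l, hl, hw⟩ := h e heR
      cases l with
      | nil => exact absurd rfl hl.1.1.1
      | cons a t =>
        have : a = e.1 := by simpa using hl.1.2.1
        subst this
        exact (tele _ c x hx _ t _ hl.1).trans hw
    · exact hx e ⟨he, heR⟩
end

section
/- Let G = (V,E,c) and G' = (V,E',c') be two feasible precedence graphs whose associated inequality systems have the same solution set. Then for every edge (f,g) ∈ E with weight c_{fg} there exists a simple path from f to g in G' of total weight at most c_{fg}; moreover, for all i,j ∈ V, i ∼ j in G if and only if i ∼ j in G'. -/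
/-- Inductive walks carrying their vertex list and weight. -/
inductive Wk {V : Type*} (E : Set (V × V)) (c : V → V → ℝ) : V → V → List V → ℝ → Prop
  | nil (u : V) : Wk E c u u [u] 0
  | cons (u v z : V) (l : List V) (w : ℝ) (h : (u, v) ∈ E) (hw : Wk E c v z l w) :
      Wk E c u z (u :: l) (c u v + w)

namespace Wk

variable {V : Type*} {E : Set (V × V)} {c : V → V → ℝ}

lemma head {u v : V} {l : List V} {w : ℝ} (h : Wk E c u v l w) : ∃ t, l = u :: t := by
  cases h <;> exact ⟨_, rfl⟩

lemma toWalk {u v : V} {l : List V} {w : ℝ} (h : Wk E c u v l w) :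
    IsWalkFrom E u v l ∧ walkWeight c l = w := by
  induction h with
  | nil u => simp [IsWalkFrom, IsWalk, walkWeight, List.Chain']
  | cons u v z l w h hw ih =>
    obtain ⟨t, rfl⟩ := hw.head
    obtain ⟨⟨⟨_, h1⟩, h2, h3⟩, h4⟩ := ih
    refine ⟨⟨⟨by simp, ?_⟩, by simp, ?_⟩, ?_⟩
    · exact List.isChain_cons_cons.2 ⟨h, h1⟩
    · simpa [List.getLast?_cons_cons] using h3
    · rw [← h4]; simp [walkWeight]

lemma ofWalk (l : List V) : ∀ {u v : V}, IsWalkFrom E u v l → Wk E c u v l (walkWeight c l) := by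
  induction l with
  | nil => intro u v h; exact absurd rfl h.1.1
  | cons a t ih =>
    intro u v h
    obtain ⟨⟨_, h1⟩, h2, h3⟩ := h
    simp only [List.head?_cons, Option.some.injEq] at h2
    subst h2
    cases t with
    | nil =>
      simp only [List.getLast?_singleton, Option.some.injEq] at h3
      subst h3
      simpa [walkWeight] using Wk.nil (E := E) (c := c) a
    | cons b t =>
      have h1' := List.isChain_cons_cons.1 h1
      have := ih (u := b) (v := v) ⟨⟨by simp, h1'.2⟩, by simp,
        by simpa [List.getLast?_cons_cons] using h3⟩
      have h5 := Wk.cons a b v _ _ h1'.1 this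
      simpa [walkWeight] using h5

lemma tele {x : V → ℝ} (hx : Satisfies E c x) {u v : V} {l : List V} {w : ℝ}
    (h : Wk E c u v l w) : x u - x v ≤ w := by
  induction h with
  | nil u => simp
  | cons u v z l w h hw ih =>
    have := hx _ h
    simp only at this
    linarith

lemma split {u v : V} {l : List V} {w : ℝ} (h : Wk E c u v l w) :
    ∀ i ∈ l, ∃ l1 l2 w1 w2, Wk E c u i l1 w1 ∧ Wk E c i v l2 w2 ∧ w = w1 + w2 ∧ l2 <:+ l := by
  induction h with
  | nil u =>
    intro i hi
    simp only [List.mem_singleton] at hi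
    subst hi
    exact ⟨_, _, _, _, Wk.nil i, Wk.nil i, by simp, List.suffix_rfl⟩
  | cons u v z l w h hw ih =>
    intro i hi
    by_cases hiu : i = u
    · subst hiu
      exact ⟨_, _, _, _, Wk.nil i, Wk.cons i v z l w h hw, by simp, List.suffix_rfl⟩
    · have hil : i ∈ l := by simpa [hiu] using hi
      obtain ⟨l1, l2, w1, w2, h1, h2, h3, h4⟩ := ih i hil
      exact ⟨_, _, _, _, Wk.cons u v i _ _ h h1, h2, by rw [h3]; ring,
        h4.trans (List.suffix_cons _ _)⟩

lemma append {u i v : V} {l1 l2 : List V} {w1 w2 : ℝ} (h1 : Wk E c u i l1 w1)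
    (h2 : Wk E c i v l2 w2) : ∃ l, Wk E c u v l (w1 + w2) ∧ l2 ⊆ l := by
  induction h1 with
  | nil u => exact ⟨l2, by simpa using h2, List.Subset.refl _⟩
  | cons a b z l w h hw ih =>
    obtain ⟨l', h3, h4⟩ := ih h2
    refine ⟨a :: l', ?_, fun z hz => List.mem_cons_of_mem _ (h4 hz)⟩
    rw [add_assoc]
    exact Wk.cons _ _ _ _ _ h h3

lemma reduce {x : V → ℝ} (hx : Satisfies E c x) {u v : V} {l : List V} {w : ℝ}
    (h : Wk E c u v l w) : ∃ l' w', Wk E c u v l' w' ∧ l'.Nodup ∧ w' ≤ w := by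
  induction h with
  | nil u => exact ⟨_, _, Wk.nil u, by simp, le_rfl⟩
  | cons u v z l w h hw ih =>
    obtain ⟨l', w', h1, h2, h3⟩ := ih
    by_cases hu : u ∈ l'
    · obtain ⟨l1, l2, w1, w2, h4, h5, h6, h7⟩ := h1.split u hu
      refine ⟨l2, w2, h5, h2.sublist h7.sublist, ?_⟩
      have := (Wk.cons _ _ _ _ _ h h4).tele hx
      linarith
    · exact ⟨_, _, Wk.cons _ _ _ _ _ h h1, List.nodup_cons.2 ⟨hu, h2⟩, by linarith⟩

lemma exists_min [Finite V] {x : V → ℝ} (hx : Satisfies E c x) (u g : V)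
    (h : ∃ l w, Wk E c u g l w) :
    ∃ d, (∃ l, Wk E c u g l d ∧ l.Nodup) ∧ ∀ l w, Wk E c u g l w → d ≤ w := by
  have := Fintype.ofFinite V
  have hfin : {d : ℝ | ∃ l, Wk E c u g l d ∧ l.Nodup}.Finite := by
    refine ((List.finite_length_le V (Fintype.card V)).image (walkWeight c)).subset ?_
    rintro d ⟨l, h1, h2⟩
    exact ⟨l, h2.length_le_card, h1.toWalk.2⟩
  obtain ⟨l, w, hw⟩ := h
  obtain ⟨l', w', h1, h2, _⟩ := hw.reduce hx
  obtain ⟨d, hd, hmin⟩ := Set.exists_min_image _ id hfin ⟨w', l', h1, h2⟩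
  refine ⟨d, hd, fun l w hw => ?_⟩
  obtain ⟨l', w', h1, h2, h3⟩ := hw.reduce hx
  exact (hmin w' ⟨l', h1, h2⟩).trans h3

lemma key [Finite V] {x0 : V → ℝ} (hx0 : Satisfies E c x0) (f g : V) (a : ℝ)
    (ha : ∀ x, Satisfies E c x → x f - x g ≤ a) :
    ∃ l w, Wk E c f g l w ∧ l.Nodup ∧ w ≤ a := by
  classical
  have hd : ∀ u, ∃ d, (∃ l w, Wk E c u g l w) →
      (∃ l, Wk E c u g l d ∧ l.Nodup) ∧ ∀ l w, Wk E c u g l w → d ≤ w := by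
    intro u
    by_cases h : ∃ l w, Wk E c u g l w
    · obtain ⟨d, hd⟩ := exists_min hx0 u g h
      exact ⟨d, fun _ => hd⟩
    · exact ⟨0, fun h' => absurd h' h⟩
  choose d hd using hd
  have hg0 : ∃ l w, Wk E c g g l w := ⟨_, _, Wk.nil g⟩
  have hdg : d g = 0 := by
    obtain ⟨⟨l, h1, _⟩, h2⟩ := hd g hg0
    have := h1.tele hx0
    have := h2 _ _ (Wk.nil g)
    linarith
  obtain ⟨M1, hM1⟩ := (Set.finite_range (fun p : V × V => d p.1 - x0 p.2 - c p.1 p.2)).bddAbove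
  set M := max M1 (a - x0 f + 1) with hM
  set x : V → ℝ := fun u => if (∃ l w, Wk E c u g l w) then d u else x0 u + M with hxdef
  have hx : Satisfies E c x := by
    rintro ⟨u, v⟩ he
    simp only [hxdef]
    by_cases hv : ∃ l w, Wk E c v g l w
    · obtain ⟨⟨l, h1, _⟩, _⟩ := hd v hv
      have h3 := Wk.cons _ _ _ _ _ he h1
      have hu : ∃ l w, Wk E c u g l w := ⟨_, _, h3⟩
      rw [if_pos hu, if_pos hv]
      have := (hd u hu).2 _ _ h3
      linarith
    · rw [if_neg hv]
      split_ifs with hu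
      · have h1 : d u - x0 v - c u v ≤ M1 := hM1 ⟨(u, v), rfl⟩
        have := le_max_left M1 (a - x0 f + 1)
        linarith
      · have := hx0 _ he
        simp only at this
        linarith
  have h := ha x hx
  simp only [hxdef] at h
  rw [if_pos hg0, hdg] at h
  split_ifs at h with hf
  · obtain ⟨⟨l, h1, h2⟩, _⟩ := hd f hf
    exact ⟨l, d f, h1, h2, by linarith⟩
  · have := le_max_right M1 (a - x0 f + 1)
    linarith

lemma sim_iff [Finite V] (hfeas : ∃ x : V → ℝ, Satisfies E c x) (i j : V) :
    Sim E c i j ↔ ∃ k, ∀ x, Satisfies E c x → x i - x j = k := by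
  constructor
  · rintro (rfl | ⟨l, ⟨hw, _, hcl⟩, h0, hi, hj⟩)
    · exact ⟨0, by simp⟩
    · obtain ⟨h, t, rfl⟩ := List.exists_cons_of_ne_nil hw.1
      have hW : Wk E c h h (h :: t) (walkWeight c (h :: t)) :=
        ofWalk _ ⟨hw, by simp, by rw [← hcl]; simp⟩
      rw [h0] at hW
      obtain ⟨_, _, a1, a2, p1, p2, p3, _⟩ := hW.split i hi
      obtain ⟨_, _, b1, b2, q1, q2, q3, _⟩ := hW.split j hj
      refine ⟨b1 - a1, fun x hx => ?_⟩
      have := p1.tele hx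
      have := p2.tele hx
      have := q1.tele hx
      have := q2.tele hx
      linarith
  · rintro ⟨k, hk⟩
    by_cases hij : i = j
    · exact Or.inl hij
    right
    obtain ⟨x0, hx0⟩ := hfeas
    obtain ⟨l1, w1, h1, _, hw1⟩ := key hx0 i j k (fun x hx => (hk x hx).le)
    obtain ⟨l2, w2, h2, _, hw2⟩ := key hx0 j i (-k) (fun x hx => by have := hk x hx; linarith)
    obtain ⟨l, h3, hsub⟩ := h1.append h2
    have hge := h3.tele hx0
    obtain ⟨h4, h5⟩ := h3.toWalk
    obtain ⟨t, rfl⟩ := h3.head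
    obtain ⟨t2, rfl⟩ := h2.head
    have hj : j ∈ i :: t := hsub (by simp)
    refine ⟨i :: t, ⟨h4.1, ?_, by rw [h4.2.1, h4.2.2]⟩, by rw [h5]; linarith, by simp, hj⟩
    have hjt : j ∈ t := by simpa [Ne.symm hij] using hj
    have := List.length_pos_of_mem hjt
    simp only [List.length_cons]
    omega

end Wk

theorem stmt19 {V : Type*} [Fintype V] (E E' : Set (V × V)) (c c' : V → V → ℝ)
    (hfeas : ∃ x : V → ℝ, Satisfies E c x)
    (hloop : ∀ i : V, (i, i) ∉ E) (hloop' : ∀ i : V, (i, i) ∉ E')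
    (hequiv : ∀ x : V → ℝ, Satisfies E c x ↔ Satisfies E' c' x) :
    (∀ e ∈ E, ∃ p : List V, IsPathFrom E' e.1 e.2 p ∧ walkWeight c' p ≤ c e.1 e.2) ∧
    (∀ i j : V, Sim E c i j ↔ Sim E' c' i j) := by
  obtain ⟨x0, hx0⟩ := hfeas
  have hx0' := (hequiv x0).1 hx0
  refine ⟨fun e he => ?_, fun i j => ?_⟩
  · obtain ⟨l, w, h1, h2, h3⟩ := Wk.key hx0' e.1 e.2 (c e.1 e.2)
      (fun x hx => (hequiv x).2 hx e he)
    obtain ⟨h4, h5⟩ := h1.toWalk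
    exact ⟨l, ⟨h4, h2⟩, by rw [h5]; exact h3⟩
  · rw [Wk.sim_iff ⟨x0, hx0⟩, Wk.sim_iff ⟨x0, hx0'⟩]
    simp only [hequiv]
end
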